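/- Let A₁,…,A_m be positive semidefinite n×n complex matrices and let Z₁,…,Z_m be n×n complex matrices with ∑ᵢ Zᵢ*Zᵢ ≤ I. Let f : [0,∞) → [0,∞) be a monotone concave function with f(0) ≥ 0. Then there exists a unitary n×n matrix V such that f(∑ᵢ Zᵢ*AᵢZᵢ) ≥ V (∑ᵢ Zᵢ*f(Aᵢ)Zᵢ) V* in the Loewner order. -/

import Mathlib

open Matrix ComplexOrder

/-- `f(A)` for a Hermitian matrix `A`: apply `f` to the eigenvalues in a spectral
decomposition of `A`. -/
noncomputable def matFn {n : ℕ} (f : ℝ → ℝ) (A : Matrix (Fin n) (Fin n) ℂ)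
    (hA : A.IsHermitian) : Matrix (Fin n) (Fin n) ℂ :=
  (hA.eigenvectorUnitary : Matrix (Fin n) (Fin n) ℂ) *
    Matrix.diagonal (fun i => (f (hA.eigenvalues i) : ℂ)) *
    (star hA.eigenvectorUnitary : Matrix (Fin n) (Fin n) ℂ)

theorem matFn_isHermitian {n : ℕ} (f : ℝ → ℝ) (A : Matrix (Fin n) (Fin n) ℂ)
    (hA : A.IsHermitian) : (matFn f A hA).IsHermitian := by
  have h1 : (Matrix.diagonal (fun i => (f (hA.eigenvalues i) : ℂ))).IsHermitian :=
    Matrix.isHermitian_diagonal_of_self_adjoint _ (by ext i; simp [Pi.star_def])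
  have h2 := Matrix.isHermitian_mul_mul_conjTranspose
    (hA.eigenvectorUnitary : Matrix (Fin n) (Fin n) ℂ) h1
  simpa [matFn, Matrix.star_eq_conjTranspose] using h2

/-- The sum of the `k` largest entries of `μ` (for the eigenvalue vector of a Hermitian
matrix, this is the Ky Fan `k`-sum of its eigenvalues). -/
noncomputable def sumKLargest {n : ℕ} (μ : Fin n → ℝ) (k : ℕ) : ℝ :=
  (((List.ofFn μ).insertionSort (· ≥ ·)).take k).sum

theorem isHermitian_sum_conj {n m : ℕ} (A Z : Fin m → Matrix (Fin n) (Fin n) ℂ)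
    (hA : ∀ i, (A i).IsHermitian) : (∑ i, (Z i)ᴴ * A i * Z i).IsHermitian := by
  rw [Matrix.IsHermitian, Matrix.conjTranspose_sum]
  exact Finset.sum_congr rfl fun i _ =>
    Matrix.isHermitian_conjTranspose_mul_mul (Z i) (hA i)

theorem monotoneOn_of_concaveOn_of_nonneg {f : ℝ → ℝ} (hf : ConcaveOn ℝ (Set.Ici 0) f)
    (hf0 : ∀ x ∈ Set.Ici (0 : ℝ), 0 ≤ f x) : MonotoneOn f (Set.Ici 0) := by
  intro x hx y hy hxy
  by_contra! h
  have hx0 : 0 ≤ x := hx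
  have hfy := hf0 y hy
  have hfx : 0 < f x := hfy.trans_lt h
  set s := (f x - f y) / (2 * f x) with hs
  have hs0 : 0 < s := div_pos (sub_pos.2 h) (by positivity)
  have hs1 : s ≤ 1 := (div_le_one (by positivity)).2 (by linarith)
  have hsf : s * f x = (f x - f y) / 2 := by rw [hs]; field_simp
  have hz : x + (y - x) / s ∈ Set.Ici (0 : ℝ) :=
    add_nonneg hx0 (div_nonneg (sub_nonneg.2 hxy) hs0.le)
  have hc := hf.2 hx hz (sub_nonneg.2 hs1) hs0.le (by ring)
  have hy' : (1 - s) • x + s • (x + (y - x) / s) = y := by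
    simp only [smul_eq_mul]
    field_simp
    ring
  rw [hy', smul_eq_mul, smul_eq_mul] at hc
  nlinarith [mul_nonneg hs0.le (hf0 _ hz)]

theorem ConcaveOn.sum_le_map_sum_of_sum_le_one {ι : Type*} [Fintype ι] {f : ℝ → ℝ}
    (hf : ConcaveOn ℝ (Set.Ici 0) f) (hf00 : 0 ≤ f 0) {w p : ι → ℝ} (hw : ∀ i, 0 ≤ w i)
    (hw1 : ∑ i, w i ≤ 1) (hp : ∀ i, 0 ≤ p i) :
    ∑ i, w i * f (p i) ≤ f (∑ i, w i * p i) := by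
  have h := hf.le_map_sum (t := (Finset.univ : Finset (Option ι)))
    (w := fun o => o.elim (1 - ∑ i, w i) w) (p := fun o => o.elim 0 p)
    (by rintro (_ | i) _ <;> simp [hw, hw1]) (by simp [Fintype.sum_option])
    (by rintro (_ | i) _ <;> simp [hp])
  simp only [Fintype.sum_option, Option.elim, smul_eq_mul, mul_zero, zero_add] at h
  linarith [mul_nonneg (sub_nonneg.2 hw1) hf00]

section QuadraticForm

variable {ι : Type*} [Fintype ι]

theorem dotProduct_star_self_eq_sum_normSq (x : ι → ℂ) :
    star x ⬝ᵥ x = ((∑ j, Complex.normSq (x j) : ℝ) : ℂ) := by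
  simp [dotProduct, Complex.normSq_eq_conj_mul_self]

theorem dotProduct_conjTranspose_mul_mul_mulVec (x : ι → ℂ) (Z M : Matrix ι ι ℂ) :
    star x ⬝ᵥ ((Zᴴ * M * Z) *ᵥ x) = star (Z *ᵥ x) ⬝ᵥ (M *ᵥ (Z *ᵥ x)) := by
  rw [star_mulVec, ← dotProduct_mulVec, mulVec_mulVec, mulVec_mulVec, mul_assoc]

variable [DecidableEq ι]

theorem dotProduct_diagonal_conj_mulVec (x : ι → ℂ) (U : Matrix ι ι ℂ) (d : ι → ℝ) :
    star x ⬝ᵥ ((U * diagonal (fun i => (d i : ℂ)) * star U) *ᵥ x) =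
      ((∑ j, d j * Complex.normSq ((star U *ᵥ x) j) : ℝ) : ℂ) := by
  have h := dotProduct_conjTranspose_mul_mul_mulVec x (star U) (diagonal fun i => (d i : ℂ))
  rw [← star_eq_conjTranspose, star_star] at h
  rw [h]
  simp only [dotProduct, mulVec_diagonal, Pi.star_apply, RCLike.star_def, Complex.ofReal_sum,
    Complex.ofReal_mul, Complex.normSq_eq_conj_mul_self]
  exact Finset.sum_congr rfl fun j _ => by ring

theorem sum_normSq_star_unitary_mulVec (x : ι → ℂ) (U : unitaryGroup ι ℂ) :
    ∑ j, Complex.normSq ((star (U : Matrix ι ι ℂ) *ᵥ x) j) = ∑ j, Complex.normSq (x j) := by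
  have h := dotProduct_diagonal_conj_mulVec x (U : Matrix ι ι ℂ) (fun _ => 1)
  have h1 : diagonal (fun _ : ι => ((1 : ℝ) : ℂ)) = 1 := by simp
  rw [h1, mul_one, mem_unitaryGroup_iff.1 U.2, one_mulVec, dotProduct_star_self_eq_sum_normSq] at h
  simpa using (Complex.ofReal_injective h).symm

theorem exists_unit_vector_mulVec_eq_zero (U W : Matrix ι ι ℂ) (p : ι → Prop) (i : ι) :
    ∃ x : ι → ℂ, ∑ j, Complex.normSq (x j) = 1 ∧
      (∀ j, j ≠ i → p j → (U *ᵥ x) j = 0) ∧ ∀ j, j ≠ i → ¬ p j → (W *ᵥ x) j = 0 := by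
  classical
  let M : Matrix {j // j ≠ i} ι ℂ := of fun j => if p j then U j else W j
  have hM : LinearMap.ker M.mulVecLin ≠ ⊥ := by
    apply LinearMap.ker_ne_bot_of_finrank_lt
    simp only [Module.finrank_fintype_fun_eq_card]
    exact Fintype.card_subtype_lt (x := i) (by simp)
  obtain ⟨x, hx, hx0⟩ := (Submodule.ne_bot_iff _).1 hM
  have hN : 0 < ∑ j, Complex.normSq (x j) := by
    obtain ⟨k, hk⟩ := Function.ne_iff.1 hx0
    exact Finset.sum_pos' (fun _ _ => Complex.normSq_nonneg _)
      ⟨k, Finset.mem_univ _, Complex.normSq_pos.2 hk⟩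
  set N := ∑ j, Complex.normSq (x j) with hNdef
  have hx' (j : ι) (hj : j ≠ i) : (if p j then (U *ᵥ x) j else (W *ᵥ x) j) = 0 := by
    have h0 : (if p j then U j else W j) ⬝ᵥ x = 0 :=
      congrFun (LinearMap.mem_ker.1 hx) ⟨j, hj⟩
    split_ifs at h0 ⊢ <;> exact h0
  refine ⟨(((Real.sqrt N)⁻¹ : ℝ) : ℂ) • x, ?_, fun j hj h => ?_, fun j hj h => ?_⟩
  · simp only [Pi.smul_apply, smul_eq_mul, Complex.normSq_mul, ← Finset.mul_sum, ← hNdef,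
      Complex.normSq_ofReal]
    rw [← mul_inv, Real.mul_self_sqrt hN.le, inv_mul_cancel₀ hN.ne']
  · have := hx' j hj
    rw [if_pos h] at this
    rw [mulVec_smul, Pi.smul_apply, this, smul_zero]
  · have := hx' j hj
    rw [if_neg h] at this
    rw [mulVec_smul, Pi.smul_apply, this, smul_zero]

theorem Matrix.IsHermitian.eq_eigenvectorUnitary_mul_diagonal_mul {A : Matrix ι ι ℂ}
    (hA : A.IsHermitian) :
    A = (hA.eigenvectorUnitary : Matrix ι ι ℂ) *
      diagonal (fun i => (hA.eigenvalues i : ℂ)) *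
      star (hA.eigenvectorUnitary : Matrix ι ι ℂ) := by
  conv_lhs => rw [hA.spectral_theorem, Unitary.conjStarAlgAut_apply]
  rfl

/-- A form of the Courant–Fischer principle: for two Hermitian matrices, some unit vector
witnesses the `i`-th eigenvalue of `B` from above and the `i`-th eigenvalue of `S` from below. -/
theorem exists_unit_vector_eigenvalues_le {B S : Matrix ι ι ℂ} (hB : B.IsHermitian)
    (hS : S.IsHermitian) (i : ι) :
    ∃ x : ι → ℂ, ∑ j, Complex.normSq (x j) = 1 ∧
      hB.eigenvalues i ≤ (star x ⬝ᵥ (B *ᵥ x)).re ∧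
      (star x ⬝ᵥ (S *ᵥ x)).re ≤ hS.eigenvalues i := by
  let e : ι ≃ Fin (Fintype.card ι) := (Fintype.equivOfCardEq (Fintype.card_fin _)).symm
  obtain ⟨x, hx, hxB, hxS⟩ := exists_unit_vector_mulVec_eq_zero
    (star (hB.eigenvectorUnitary : Matrix ι ι ℂ)) (star (hS.eigenvectorUnitary : Matrix ι ι ℂ))
    (fun j => e i < e j) i
  have hanti {C : Matrix ι ι ℂ} (hC : C.IsHermitian) {k j : ι} (h : e k ≤ e j) :
      hC.eigenvalues j ≤ hC.eigenvalues k := hC.eigenvalues₀_antitone h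
  refine ⟨x, hx, ?_, ?_⟩
  · rw [congrArg (fun M => (star x ⬝ᵥ (M *ᵥ x)).re) hB.eq_eigenvectorUnitary_mul_diagonal_mul]
    rw [dotProduct_diagonal_conj_mulVec, Complex.ofReal_re, ← mul_one (hB.eigenvalues i), ← hx,
      ← sum_normSq_star_unitary_mulVec x hB.eigenvectorUnitary, Finset.mul_sum]
    refine Finset.sum_le_sum fun j _ => ?_
    by_cases h : e i < e j
    · simp [hxB j (by rintro rfl; exact lt_irrefl _ h) h]
    · exact mul_le_mul_of_nonneg_right (hanti hB (not_lt.1 h)) (Complex.normSq_nonneg _)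
  · rw [congrArg (fun M => (star x ⬝ᵥ (M *ᵥ x)).re) hS.eq_eigenvectorUnitary_mul_diagonal_mul]
    rw [dotProduct_diagonal_conj_mulVec, Complex.ofReal_re, ← mul_one (hS.eigenvalues i), ← hx,
      ← sum_normSq_star_unitary_mulVec x hS.eigenvectorUnitary, Finset.mul_sum]
    refine Finset.sum_le_sum fun j _ => ?_
    by_cases h : e i ≤ e j
    · exact mul_le_mul_of_nonneg_right (hanti hS h) (Complex.normSq_nonneg _)
    · simp [hxS j (by rintro rfl; exact h le_rfl) fun h' => h h'.le]

end QuadraticForm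

theorem re_dotProduct_sum_matFn_le {n m : ℕ} (A Z : Fin m → Matrix (Fin n) (Fin n) ℂ)
    (hA : ∀ i, (A i).PosSemidef)
    (hZ : ((1 : Matrix (Fin n) (Fin n) ℂ) - ∑ i, (Z i)ᴴ * Z i).PosSemidef)
    {f : ℝ → ℝ} (hf : ConcaveOn ℝ (Set.Ici 0) f) (hf00 : 0 ≤ f 0) {x : Fin n → ℂ}
    (hx : ∑ j, Complex.normSq (x j) = 1) :
    (star x ⬝ᵥ ((∑ i, (Z i)ᴴ * matFn f (A i) (hA i).1 * Z i) *ᵥ x)).re ≤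
      f (star x ⬝ᵥ ((∑ i, (Z i)ᴴ * A i * Z i) *ᵥ x)).re := by
  have hsum (M : Fin m → Matrix (Fin n) (Fin n) ℂ) :
      star x ⬝ᵥ ((∑ i, (Z i)ᴴ * M i * Z i) *ᵥ x) =
        ∑ i, star (Z i *ᵥ x) ⬝ᵥ (M i *ᵥ (Z i *ᵥ x)) := by
    simp_rw [sum_mulVec, dotProduct_sum, dotProduct_conjTranspose_mul_mul_mulVec]
  let w (q : Fin m × Fin n) : ℝ := Complex.normSq
    ((star ((hA q.1).1.eigenvectorUnitary : Matrix (Fin n) (Fin n) ℂ) *ᵥ (Z q.1 *ᵥ x)) q.2)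
  have hw1 : ∑ q, w q ≤ 1 := by
    have h := hZ.re_dotProduct_nonneg x
    have h1 := hsum fun _ => 1
    simp only [mul_one, one_mulVec, dotProduct_star_self_eq_sum_normSq] at h1
    rw [sub_mulVec, dotProduct_sub, one_mulVec, dotProduct_star_self_eq_sum_normSq, hx, h1,
      ← Complex.ofReal_sum, ← Complex.ofReal_sub, RCLike.re_eq_complex_re, Complex.ofReal_re] at h
    rw [Fintype.sum_prod_type, Finset.sum_congr rfl fun i _ =>
      sum_normSq_star_unitary_mulVec (Z i *ᵥ x) (hA i).1.eigenvectorUnitary]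
    linarith
  have key := hf.sum_le_map_sum_of_sum_le_one hf00 (w := w)
    (p := fun q => (hA q.1).1.eigenvalues q.2) (fun q => Complex.normSq_nonneg _) hw1
    fun q => (hA q.1).eigenvalues_nonneg q.2
  have hB : (star x ⬝ᵥ ((∑ i, (Z i)ᴴ * matFn f (A i) (hA i).1 * Z i) *ᵥ x)).re =
      ∑ q, w q * f ((hA q.1).1.eigenvalues q.2) := by
    rw [hsum, Complex.re_sum, Fintype.sum_prod_type]
    refine Finset.sum_congr rfl fun i _ => ?_
    rw [matFn, dotProduct_diagonal_conj_mulVec, Complex.ofReal_re]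
    exact Finset.sum_congr rfl fun j _ => mul_comm _ _
  have hS : (star x ⬝ᵥ ((∑ i, (Z i)ᴴ * A i * Z i) *ᵥ x)).re =
      ∑ q, w q * (hA q.1).1.eigenvalues q.2 := by
    rw [hsum, Complex.re_sum, Fintype.sum_prod_type]
    refine Finset.sum_congr rfl fun i _ => ?_
    rw [congrArg (fun M => (star (Z i *ᵥ x) ⬝ᵥ (M *ᵥ (Z i *ᵥ x))).re)
      (hA i).1.eq_eigenvectorUnitary_mul_diagonal_mul, dotProduct_diagonal_conj_mulVec,
      Complex.ofReal_re]
    exact Finset.sum_congr rfl fun j _ => mul_comm _ _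
  rwa [hB, hS]

theorem exists_unitary_matFn_sub_posSemidef {n : ℕ} {B S : Matrix (Fin n) (Fin n) ℂ}
    (hB : B.IsHermitian) (hS : S.IsHermitian) {f : ℝ → ℝ}
    (h : ∀ i, hB.eigenvalues i ≤ f (hS.eigenvalues i)) :
    ∃ V ∈ unitaryGroup (Fin n) ℂ, (matFn f S hS - V * B * Vᴴ).PosSemidef := by
  set U := hS.eigenvectorUnitary with hU
  set W := hB.eigenvectorUnitary with hW
  refine ⟨(U * star W : unitaryGroup (Fin n) ℂ), (U * star W).2, ?_⟩
  have hVB : ((U * star W : unitaryGroup (Fin n) ℂ) : Matrix (Fin n) (Fin n) ℂ) * B *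
      ((U * star W : unitaryGroup (Fin n) ℂ) : Matrix (Fin n) (Fin n) ℂ)ᴴ =
      (U : Matrix (Fin n) (Fin n) ℂ) * diagonal (fun i => (hB.eigenvalues i : ℂ)) *
        (U : Matrix (Fin n) (Fin n) ℂ)ᴴ := by
    have hWW : star (W : Matrix (Fin n) (Fin n) ℂ) * W = 1 := Unitary.coe_star_mul_self W
    have hBW : star (W : Matrix (Fin n) (Fin n) ℂ) * B * W =
        diagonal (fun i => (hB.eigenvalues i : ℂ)) := by
      rw [congrArg (fun M => star (W : Matrix (Fin n) (Fin n) ℂ) * M * W)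
        hB.eq_eigenvectorUnitary_mul_diagonal_mul, ← hW]
      simp only [mul_assoc, hWW, mul_one]
      rw [← mul_assoc, hWW, one_mul]
    rw [← hBW]
    simp [← star_eq_conjTranspose, mul_assoc]
  rw [hVB, matFn, ← hU, star_eq_conjTranspose, ← sub_mul, ← mul_sub, diagonal_sub]
  refine PosSemidef.mul_mul_conjTranspose_same (posSemidef_diagonal_iff.2 fun i => ?_) _
  rw [← Complex.ofReal_sub]
  exact Complex.zero_le_real.2 (sub_nonneg.2 (h i))

/-- For positive semidefinite `Aᵢ`, matrices `Zᵢ` with `∑ Zᵢ* Zᵢ ≤ I` and a monotone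
concave function `f : [0,∞) → [0,∞)` with `f(0) ≥ 0`, there is a unitary `V` with
`f(∑ Zᵢ* Aᵢ Zᵢ) ≥ V (∑ Zᵢ* f(Aᵢ) Zᵢ) V*` in the Loewner order. -/
theorem concave_jensen_sum_contraction_unitary {n m : ℕ}
    (A Z : Fin m → Matrix (Fin n) (Fin n) ℂ)
    (hA : ∀ i, (A i).PosSemidef)
    (hZ : ((1 : Matrix (Fin n) (Fin n) ℂ) - ∑ i, (Z i)ᴴ * Z i).PosSemidef)
    (f : ℝ → ℝ) (hf : ConcaveOn ℝ (Set.Ici 0) f)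
    (hmono : MonotoneOn f (Set.Ici 0) ∨ AntitoneOn f (Set.Ici 0))
    (hf0 : ∀ x ∈ Set.Ici (0 : ℝ), 0 ≤ f x) (hf00 : 0 ≤ f 0) :
    ∃ V ∈ Matrix.unitaryGroup (Fin n) ℂ,
      (matFn f _ (isHermitian_sum_conj A Z fun i => (hA i).1) -
        V * (∑ i, (Z i)ᴴ * matFn f (A i) (hA i).1 * Z i) * Vᴴ).PosSemidef := by
  have hS : (∑ i, (Z i)ᴴ * A i * Z i).PosSemidef :=
    posSemidef_sum _ fun i _ => (hA i).conjTranspose_mul_mul_same (Z i)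
  have hB := isHermitian_sum_conj (fun i => matFn f (A i) (hA i).1) Z
    fun i => matFn_isHermitian f (A i) (hA i).1
  refine exists_unitary_matFn_sub_posSemidef hB _ fun i => ?_
  obtain ⟨x, hx, hxB, hxS⟩ := exists_unit_vector_eigenvalues_le hB hS.1 i
  exact hxB.trans <| (re_dotProduct_sum_matFn_le A Z hA hZ hf hf00 hx).trans <|
    monotoneOn_of_concaveOn_of_nonneg hf hf0 (hS.re_dotProduct_nonneg x)
      (hS.eigenvalues_nonneg i) hxS
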